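/- Let X be a finite T₀ topological space and suppose that the simple undirected graph on the vertex set X, with an edge between two points whenever one covers the other in the specialization order, is acyclic (i.e. a forest). Then X is an EBP space: X is a unique path space, and every elementary boundary pair (U, C) in X is of the form (õ{x}, closure {y}) for some points x, y ∈ X with x covering y. -/

import Mathlib

open Set Topology

variable {X : Type*} [TopologicalSpace X]

/-- Specialization order: `x ≤ y` iff `x ∈ closure {y}`. -/
def SpecLE (x y : X) : Prop := x ∈ closure ({y} : Set X)

/-- Strict specialization order. -/
def SpecLT (x y : X) : Prop := SpecLE x y ∧ ¬ SpecLE y x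

/-- `CoversRel y x` means `y → x`: `x < y` and there is no `z` with `x < z < y`. -/
def CoversRel (y x : X) : Prop := SpecLT x y ∧ ∀ z : X, ¬ (SpecLT x z ∧ SpecLT z y)

/-- `IsPathList y x l`: the list `l = [z₁, …, zₙ]` is a path from `y` to `x`, i.e.
`z₁ = x`, `zₙ = y` and `z_{k+1}` covers `z_k` for each `k`. -/
def IsPathList (y x : X) (l : List X) : Prop :=
  l ≠ [] ∧ l.head? = some x ∧ l.getLast? = some y ∧ l.Chain' (fun a b => CoversRel b a)

/-- `X` is a unique path space if for all `x, y` there is at most one path from `y` to `x`. -/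
def UniquePathSpace (X : Type*) [TopologicalSpace X] : Prop :=
  ∀ x y : X, ∀ l₁ l₂ : List X, IsPathList y x l₁ → IsPathList y x l₂ → l₁ = l₂

/-- The smallest open set containing a set `S` (in a finite space this is open). -/
def tildeSet (S : Set X) : Set X := ⋂₀ {U : Set X | IsOpen U ∧ S ⊆ U}

/-- The smallest open set containing the point `x`, denoted `õ{x}`. -/
def osi (x : X) : Set X := tildeSet {x}

/-- `S` is locally closed: `S = U \ V` for open sets `V ⊆ U`. -/
def LocClosed (S : Set X) : Prop :=
  ∃ U V : Set X, IsOpen U ∧ IsOpen V ∧ V ⊆ U ∧ S = U \ V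

/-- `S` is relatively open in `T`. -/
def RelOpen (S T : Set X) : Prop := ∃ O : Set X, IsOpen O ∧ S = O ∩ T

/-- `S` is relatively closed in `T`. -/
def RelClosed (S T : Set X) : Prop := ∃ Z : Set X, IsClosed Z ∧ S = Z ∩ T

/-- `(U, C)` is a boundary pair: `Y = U ∪ C` is locally closed, `U` is open in `Y`,
and `C = Y \ U`. -/
def BoundaryPair (U C : Set X) : Prop :=
  LocClosed (U ∪ C) ∧ RelOpen U (U ∪ C) ∧ C = (U ∪ C) \ U

/-- An elementary boundary pair. -/
def ElementaryBP (U C : Set X) : Prop :=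
  BoundaryPair U C ∧ IsConnected U ∧ IsConnected C ∧ IsOpen U ∧ IsClosed C ∧
    U ⊆ tildeSet C ∧ C ⊆ closure U

/-- `X` is an EBP space: a unique path space in which every elementary boundary pair is
of the form `(õ{x}, closure {y})` with `x` covering `y`. -/
def IsEBP (X : Type*) [TopologicalSpace X] : Prop :=
  UniquePathSpace X ∧
    ∀ U C : Set X, ElementaryBP U C →
      ∃ x y : X, CoversRel x y ∧ U = osi x ∧ C = closure ({y} : Set X)

section Order

variable {α : Type*} [PartialOrder α]

theorem reflTransGen_covBy_of_le_of_finite [Finite α] {a b : α} (hab : a ≤ b) :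
    Relation.ReflTransGen (· ⋖ ·) a b := by
  classical
  have := Fintype.ofFinite α
  let _ : LocallyFiniteOrder α := Fintype.toLocallyFiniteOrder
  exact le_iff_reflTransGen_covBy.mp hab

theorem le_of_reflTransGen_covBy {a b : α} (h : Relation.ReflTransGen (· ⋖ ·) a b) : a ≤ b := by
  induction h with
  | refl => exact le_rfl
  | tail _ hcb ih => exact ih.trans hcb.le

/-- Comparable points of an order-connected set `S` are joined in every graph containing the
covering relations inside `S`. -/
theorem reachable_of_le_of_ordConnected [Finite α] {S : Set α} (hS : S.OrdConnected)
    {H : SimpleGraph α} (hH : ∀ a ∈ S, ∀ b ∈ S, a ⋖ b → H.Adj a b) {a b : α} (ha : a ∈ S)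
    (hb : b ∈ S) (hab : a ≤ b) : H.Reachable a b := by
  have hchain := reflTransGen_covBy_of_le_of_finite hab
  clear hab
  induction hchain with
  | refl => rfl
  | @tail c b hac hcb ih =>
    have hc : c ∈ S := hS.out ha hb ⟨le_of_reflTransGen_covBy hac, hcb.le⟩
    exact (ih hc).trans (hH c hc b hb hcb).reachable

theorem not_reachable_deleteEdges_of_covBy (hG : (SimpleGraph.hasse α).IsAcyclic) {x y : α}
    (hxy : x ⋖ y) : ¬ ((SimpleGraph.hasse α).deleteEdges {s(x, y)}).Reachable x y :=
  SimpleGraph.isBridge_iff.mp (SimpleGraph.isAcyclic_iff_forall_adj_isBridge.mp hG (Or.inl hxy))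

/-- In a finite poset with acyclic Hasse diagram, two upper covers of a point with a common upper
bound coincide. -/
theorem covBy_unique_of_le [Finite α] (hG : (SimpleGraph.hasse α).IsAcyclic) {x a b y : α}
    (ha : x ⋖ a) (hb : x ⋖ b) (hay : a ≤ y) (hby : b ≤ y) : a = b := by
  by_contra hab
  have hH : ∀ c ∈ Ioi x, ∀ d ∈ Ioi x, c ⋖ d →
      ((SimpleGraph.hasse α).deleteEdges {s(x, a)}).Adj c d := by
    intro c hc d hd hcd
    rw [SimpleGraph.deleteEdges_adj]
    refine ⟨Or.inl hcd, ?_⟩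
    have := hc.ne
    have := hd.ne
    simp only [Set.mem_singleton_iff, Sym2.eq_iff]
    grind
  have hxb : ((SimpleGraph.hasse α).deleteEdges {s(x, a)}).Adj x b := by
    rw [SimpleGraph.deleteEdges_adj]
    refine ⟨Or.inl hb, ?_⟩
    simp only [Set.mem_singleton_iff, Sym2.eq_iff]
    grind
  have hy : y ∈ Ioi x := ha.lt.trans_le hay
  exact not_reachable_deleteEdges_of_covBy hG ha <| hxb.reachable.trans <|
    (reachable_of_le_of_ordConnected ordConnected_Ioi hH hb.lt hy hby).trans
    (reachable_of_le_of_ordConnected ordConnected_Ioi hH ha.lt hy hay).symm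

theorem le_getLast_of_isChain_covBy {x y : α} {l : List α} (hl : (x :: l).IsChain (· ⋖ ·))
    (hy : (x :: l).getLast? = some y) : x ≤ y := by
  induction l generalizing x with
  | nil => simp_all
  | cons a l ih =>
    rw [List.isChain_cons_cons] at hl
    rw [List.getLast?_cons_cons] at hy
    exact hl.1.le.trans (ih hl.2 hy)

theorem eq_of_isChain_covBy [Finite α] (hG : (SimpleGraph.hasse α).IsAcyclic) {x y : α}
    {l₁ l₂ : List α} (h₁ : (x :: l₁).IsChain (· ⋖ ·)) (h₂ : (x :: l₂).IsChain (· ⋖ ·))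
    (hy₁ : (x :: l₁).getLast? = some y) (hy₂ : (x :: l₂).getLast? = some y) : l₁ = l₂ := by
  induction l₁ generalizing x l₂ with
  | nil =>
    cases l₂ with
    | nil => rfl
    | cons b l₂ =>
      rw [List.isChain_cons_cons] at h₂
      rw [List.getLast?_cons_cons] at hy₂
      obtain rfl : x = y := by simpa using hy₁
      exact absurd (le_getLast_of_isChain_covBy h₂.2 hy₂) h₂.1.lt.not_ge
  | cons a l₁ ih =>
    rw [List.isChain_cons_cons] at h₁
    rw [List.getLast?_cons_cons] at hy₁
    cases l₂ with
    | nil =>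
      obtain rfl : x = y := by simpa using hy₂
      exact absurd (le_getLast_of_isChain_covBy h₁.2 hy₁) h₁.1.lt.not_ge
    | cons b l₂ =>
      rw [List.isChain_cons_cons] at h₂
      rw [List.getLast?_cons_cons] at hy₂
      obtain rfl := covBy_unique_of_le hG h₁.1 h₂.1 (le_getLast_of_isChain_covBy h₁.2 hy₁)
        (le_getLast_of_isChain_covBy h₂.2 hy₂)
      rw [ih h₁.2 h₂.2 hy₁ hy₂]

/-- A comparable pair `c ≤ u` with `c ∈ C`, `u ∈ U` straddles a covering pair from `C` to `U` when
`U` and `C` are disjoint with order-connected union. -/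
theorem exists_covBy_of_ordConnected_union [Finite α] {U C : Set α} (hUC : Disjoint U C)
    (hY : (U ∪ C).OrdConnected) {c u : α} (hc : c ∈ C) (hu : u ∈ U) (hcu : c ≤ u) :
    ∃ c' ∈ C, ∃ u' ∈ U, c' ⋖ u' ∧ c ≤ c' ∧ u' ≤ u := by
  have hchain := reflTransGen_covBy_of_le_of_finite hcu
  clear hcu
  induction hchain with
  | refl => exact absurd hc (disjoint_left.mp hUC hu)
  | @tail w u hcw hwu ih =>
    have hcw := le_of_reflTransGen_covBy hcw
    rcases hY.out (Or.inr hc) (Or.inl hu) ⟨hcw, hwu.le⟩ with hw | hw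
    · obtain ⟨c', hc', u', hu', h, hcc', huw⟩ := ih hw
      exact ⟨c', hc', u', hu', h, hcc', huw.trans hwu.le⟩
    · exact ⟨w, hw, u, hu, hwu, hcw, le_rfl⟩

end Order

section Specialization

variable {X : Type*} [TopologicalSpace X] [T0Space X]

attribute [local instance] specializationOrder

theorem specLE_iff_le {x y : X} : SpecLE x y ↔ x ≤ y :=
  specializes_iff_mem_closure.symm

theorem coversRel_iff_covBy {x y : X} : CoversRel y x ↔ x ⋖ y := by
  simp only [CoversRel, SpecLT, specLE_iff_le, ← lt_iff_le_not_ge, CovBy, not_and]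

theorem fromRel_coversRel_eq_hasse :
    SimpleGraph.fromRel (fun a b : X => CoversRel a b) = SimpleGraph.hasse X := by
  ext a b
  simp only [SimpleGraph.fromRel_adj, coversRel_iff_covBy, SimpleGraph.hasse_adj]
  grind [CovBy.ne]

theorem isUpperSet_of_isOpen {U : Set X} (hU : IsOpen U) : IsUpperSet U :=
  fun _ _ hab ha => Specializes.mem_open hab hU ha

theorem isLowerSet_of_isClosed {C : Set X} (hC : IsClosed C) : IsLowerSet C :=
  fun _ _ hab ha => Specializes.mem_closed hab hC ha

theorem LocClosed.ordConnected {S : Set X} (hS : LocClosed S) : S.OrdConnected := by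
  obtain ⟨U, V, hU, hV, -, rfl⟩ := hS
  exact ⟨fun a ha b hb z hz => ⟨isUpperSet_of_isOpen hU hz.1 ha.1,
    fun hzV => hb.2 (isUpperSet_of_isOpen hV hz.2 hzV)⟩⟩

theorem eq_osi_of_isOpen {U : Set X} {x : X} (hU : IsOpen U) (hx : x ∈ U)
    (h : ∀ u ∈ U, x ≤ u) : U = osi x := by
  refine Subset.antisymm (fun u hu => ?_) (sInter_subset_of_mem ⟨hU, by simpa using hx⟩)
  rintro O ⟨hO, hxO⟩
  exact isUpperSet_of_isOpen hO (h u hu) (hxO rfl)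

theorem eq_closure_singleton_of_isClosed {C : Set X} {y : X} (hC : IsClosed C) (hy : y ∈ C)
    (h : ∀ c ∈ C, c ≤ y) : C = closure {y} :=
  Subset.antisymm (fun c hc => specLE_iff_le.mpr (h c hc))
    (closure_minimal (by simpa using hy) hC)

variable [Finite X]

theorem isOpen_of_isUpperSet {U : Set X} (hU : IsUpperSet U) : IsOpen U :=
  isOpen_iff_forall_specializes.mpr fun _ _ hxy hy => hU hxy hy

theorem exists_le_of_mem_tildeSet {C : Set X} {u : X} (hu : u ∈ tildeSet C) : ∃ c ∈ C, c ≤ u :=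
  mem_upperClosure.mp <| hu (upperClosure C : Set X)
    ⟨isOpen_of_isUpperSet (upperClosure C).upper, subset_upperClosure⟩

theorem exists_ge_of_mem_closure {U : Set X} {c : X} (hc : c ∈ closure U) : ∃ u ∈ U, c ≤ u := by
  obtain ⟨u, hu, huU⟩ := mem_closure_iff.mp hc (Ici c) (isOpen_of_isUpperSet (isUpperSet_Ici c))
    self_mem_Ici
  exact ⟨u, huU, hu⟩

/-- Points of a preconnected order-connected set `S` are joined in every graph containing the
covering relations inside `S`. -/
theorem IsPreconnected.reachable {S : Set X} (hS : IsPreconnected S) (hS' : S.OrdConnected)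
    {H : SimpleGraph X} (hH : ∀ a ∈ S, ∀ b ∈ S, a ⋖ b → H.Adj a b) {a b : X} (ha : a ∈ S)
    (hb : b ∈ S) : H.Reachable a b := by
  by_contra hab
  obtain ⟨z, hzS, hz₁, hz₂⟩ := hS (upperClosure {c ∈ S | H.Reachable a c})
    (upperClosure {c ∈ S | ¬ H.Reachable a c})
    (isOpen_of_isUpperSet (upperClosure _).upper) (isOpen_of_isUpperSet (upperClosure _).upper)
    (fun c hc => (em (H.Reachable a c)).imp (fun h => subset_upperClosure ⟨hc, h⟩)
      (fun h => subset_upperClosure ⟨hc, h⟩))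
    ⟨a, ha, subset_upperClosure ⟨ha, .rfl⟩⟩ ⟨b, hb, subset_upperClosure ⟨hb, hab⟩⟩
  obtain ⟨c, ⟨hcS, hc⟩, hcz⟩ := mem_upperClosure.mp hz₁
  obtain ⟨d, ⟨hdS, hd⟩, hdz⟩ := mem_upperClosure.mp hz₂
  exact hd <| (hc.trans (reachable_of_le_of_ordConnected hS' hH hcS hzS hcz)).trans
    (reachable_of_le_of_ordConnected hS' hH hdS hzS hdz).symm

/-- At most one edge of an acyclic Hasse diagram joins two disjoint connected sets. -/
theorem covBy_unique_of_isPreconnected (hG : (SimpleGraph.hasse X).IsAcyclic) {U C : Set X}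
    (hUC : Disjoint U C) (hU : IsPreconnected U) (hU' : U.OrdConnected) (hC : IsPreconnected C)
    (hC' : C.OrdConnected) {c d u v : X} (hc : c ∈ C) (hd : d ∈ C) (hu : u ∈ U) (hv : v ∈ U)
    (hcu : c ⋖ u) (hdv : d ⋖ v) : d = c ∧ v = u := by
  by_contra hne
  have hadj : ∀ a b : X, a ⋖ b → s(a, b) ≠ s(c, u) →
      ((SimpleGraph.hasse X).deleteEdges {s(c, u)}).Adj a b := fun a b hab h =>
    SimpleGraph.deleteEdges_adj.mpr ⟨Or.inl hab, h⟩
  have hcU : c ∉ U := disjoint_right.mp hUC hc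
  have huC : u ∉ C := disjoint_left.mp hUC hu
  have hdU : d ∉ U := disjoint_right.mp hUC hd
  refine not_reachable_deleteEdges_of_covBy hG hcu <|
    ((hC.reachable hC' (fun a ha b hb hab => hadj a b hab ?_) hc hd).trans
    (hadj d v hdv ?_).reachable).trans
    (hU.reachable hU' (fun a ha b hb hab => hadj a b hab ?_) hv hu)
  all_goals
    rw [Ne, Sym2.eq_iff]
    grind

theorem uniquePathSpace_of_isAcyclic (hG : (SimpleGraph.hasse X).IsAcyclic) :
    UniquePathSpace X := by
  rintro x y l₁ l₂ ⟨-, hx₁, hy₁, h₁⟩ ⟨-, hx₂, hy₂, h₂⟩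
  obtain ⟨l₁, rfl⟩ := List.head?_eq_some_iff.mp hx₁
  obtain ⟨l₂, rfl⟩ := List.head?_eq_some_iff.mp hx₂
  simp only [coversRel_iff_covBy] at h₁ h₂
  rw [eq_of_isChain_covBy hG h₁ h₂ hy₁ hy₂]

theorem ElementaryBP.exists_covBy (hG : (SimpleGraph.hasse X).IsAcyclic) {U C : Set X}
    (hUC : ElementaryBP U C) : ∃ x y : X, y ⋖ x ∧ U = osi x ∧ C = closure {y} := by
  obtain ⟨⟨hY, -, hCeq⟩, hUconn, hCconn, hU, hC, hUC, hCU⟩ := hUC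
  have hdisj : Disjoint U C := by
    rw [hCeq]
    exact disjoint_sdiff_right
  have hedge {c u : X} (hc : c ∈ C) (hu : u ∈ U) (hcu : c ≤ u) :=
    exists_covBy_of_ordConnected_union hdisj hY.ordConnected hc hu hcu
  obtain ⟨u, hu⟩ := hUconn.nonempty
  obtain ⟨c, hc, hcu⟩ := exists_le_of_mem_tildeSet (hUC hu)
  obtain ⟨y, hy, x, hx, hyx, -, -⟩ := hedge hc hu hcu
  have huniq {d v : X} (hd : d ∈ C) (hv : v ∈ U) (hdv : d ⋖ v) : d = y ∧ v = x :=
    covBy_unique_of_isPreconnected hG hdisj hUconn.isPreconnected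
      (isUpperSet_of_isOpen hU).ordConnected hCconn.isPreconnected
      (isLowerSet_of_isClosed hC).ordConnected hy hd hx hv hyx hdv
  refine ⟨x, y, hyx, eq_osi_of_isOpen hU hx fun v hv => ?_,
    eq_closure_singleton_of_isClosed hC hy fun d hd => ?_⟩
  · obtain ⟨d, hd, hdv⟩ := exists_le_of_mem_tildeSet (hUC hv)
    obtain ⟨d', hd', v', hv', h, -, hle⟩ := hedge hd hv hdv
    exact (huniq hd' hv' h).2 ▸ hle
  · obtain ⟨v, hv, hdv⟩ := exists_ge_of_mem_closure (hCU hd)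
    obtain ⟨d', hd', v', hv', h, hle, -⟩ := hedge hd hv hdv
    exact (huniq hd' hv' h).1 ▸ hle

end Specialization

theorem stmt_5 {X : Type*} [TopologicalSpace X] [Finite X] [T0Space X]
    (h : (SimpleGraph.fromRel (fun a b : X => CoversRel a b)).IsAcyclic) :
    IsEBP X := by
  rw [fromRel_coversRel_eq_hasse] at h
  refine ⟨uniquePathSpace_of_isAcyclic h, fun U C hUC => ?_⟩
  obtain ⟨x, y, hyx, hx, hy⟩ := hUC.exists_covBy h
  exact ⟨x, y, coversRel_iff_covBy.mpr hyx, hx, hy⟩
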